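/- For every τ in the complex upper half-plane, the theta products f(τ) = θ₂(2τ)θ₂(6τ) and g(τ) = θ₃(2τ)θ₃(6τ) are expressed through the hexagonal lattice theta function by f(τ) = (2/3)·(A₃(τ) − A₃(4τ)) and g(τ) = (1/3)·A₃(τ) + (2/3)·A₃(4τ). -/

import Mathlib

noncomputable def theta2 (τ : ℂ) : ℂ :=
  ∑' n : ℤ, Complex.exp (Real.pi * Complex.I * ((n : ℂ) + 1/2)^2 * τ)

noncomputable def theta3 (τ : ℂ) : ℂ :=
  ∑' n : ℤ, Complex.exp (Real.pi * Complex.I * (n : ℂ)^2 * τ)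

noncomputable def theta4 (τ : ℂ) : ℂ :=
  ∑' n : ℤ, (-1 : ℂ)^n * Complex.exp (Real.pi * Complex.I * (n : ℂ)^2 * τ)
noncomputable def A3 (τ : ℂ) : ℂ :=
  ∑' p : ℤ × ℤ, Complex.exp (2 * Real.pi * Complex.I *
    ((p.1 : ℂ)^2 + (p.1 : ℂ) * (p.2 : ℂ) + (p.2 : ℂ)^2) * τ)

noncomputable def B3 (τ : ℂ) : ℂ :=
  ∑' p : ℤ × ℤ, Complex.exp (2 * Real.pi * Complex.I * ((p.1 : ℂ) - (p.2 : ℂ)) / 3) *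
    Complex.exp (2 * Real.pi * Complex.I *
      ((p.1 : ℂ)^2 + (p.1 : ℂ) * (p.2 : ℂ) + (p.2 : ℂ)^2) * τ)

noncomputable def C3 (τ : ℂ) : ℂ :=
  ∑' p : ℤ × ℤ, Complex.exp (2 * Real.pi * Complex.I *
    ((p.1 : ℂ)^2 + (p.1 : ℂ) * (p.2 : ℂ) + (p.2 : ℂ)^2 + (p.1 : ℂ) + (p.2 : ℂ) + 1/3) * τ)

/-- The general term of the hexagonal lattice theta function. -/
noncomputable def hexTerm (τ : ℂ) (p : ℤ × ℤ) : ℂ :=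
  Complex.exp (2 * Real.pi * Complex.I *
    ((p.1 : ℂ)^2 + (p.1 : ℂ) * (p.2 : ℂ) + (p.2 : ℂ)^2) * τ)

lemma summable_theta3_term {τ : ℂ} (hτ : 0 < τ.im) :
    Summable fun n : ℤ => Complex.exp (Real.pi * Complex.I * (n : ℂ)^2 * τ) := by
  refine ((summable_jacobiTheta₂_term_iff 0 τ).2 hτ).congr fun n => ?_
  simp [jacobiTheta₂_term]

lemma summable_theta2_term {τ : ℂ} (hτ : 0 < τ.im) :
    Summable fun n : ℤ => Complex.exp (Real.pi * Complex.I * ((n : ℂ) + 1/2)^2 * τ) := by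
  refine (((summable_jacobiTheta₂_term_iff (τ / 2) τ).2 hτ).mul_left
    (Complex.exp (Real.pi * Complex.I * τ / 4))).congr fun n => ?_
  rw [jacobiTheta₂_term, ← Complex.exp_add]
  ring_nf

lemma hasSum_mul_of_summable {f g : ℤ → ℂ} (hf : Summable f) (hg : Summable g) :
    HasSum (fun p : ℤ × ℤ => f p.1 * g p.2) ((∑' n, f n) * ∑' n, g n) := by
  rw [tsum_mul_tsum_of_summable_norm hf.norm hg.norm]
  exact (summable_mul_of_summable_norm hf.norm hg.norm).hasSum

/-- Every parametrization `e` of a sublattice by the form `a² + 3b²` gives a theta product. -/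
lemma hasSum_indicator_theta3_mul {τ : ℂ} (hτ : 0 < τ.im) {e : ℤ × ℤ → ℤ × ℤ}
    (he : Function.Injective e)
    (hQ : ∀ p, (e p).1^2 + (e p).1 * (e p).2 + (e p).2^2 = p.1^2 + 3 * p.2^2) :
    HasSum ((Set.range e).indicator (hexTerm τ)) (theta3 (2 * τ) * theta3 (6 * τ)) := by
  rw [← hasSum_subtype_iff_indicator]
  refine he.hasSum_range_iff.2 ((hasSum_mul_of_summable
    (summable_theta3_term (τ := 2 * τ) (by simpa using hτ))
    (summable_theta3_term (τ := 6 * τ) (by simpa using hτ))).congr_fun fun p => ?_)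
  have h : ((e p).1 : ℂ)^2 + (e p).1 * (e p).2 + ((e p).2 : ℂ)^2 = p.1^2 + 3 * p.2^2 := by
    exact_mod_cast hQ p
  simp only [Function.comp_apply, hexTerm]
  rw [h, ← Complex.exp_add]
  ring_nf

lemma hasSum_snd_even {τ : ℂ} (hτ : 0 < τ.im) :
    HasSum ({p : ℤ × ℤ | Even p.2}.indicator (hexTerm τ))
      (theta3 (2 * τ) * theta3 (6 * τ)) := by
  have hr : {p : ℤ × ℤ | Even p.2} = Set.range fun p : ℤ × ℤ => (p.1 - p.2, 2 * p.2) := by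
    ext ⟨m, n⟩
    simp only [Set.mem_ofPred_eq, Set.mem_range, Prod.exists, Prod.mk.injEq]
    exact ⟨fun ⟨k, hk⟩ => ⟨m + k, k, by omega⟩, fun ⟨a, b, h⟩ => ⟨b, by omega⟩⟩
  rw [hr]
  refine hasSum_indicator_theta3_mul hτ ?_ fun p => by ring
  rintro ⟨a, b⟩ ⟨c, d⟩ h
  simp only [Prod.mk.injEq] at h ⊢
  omega

lemma hasSum_fst_even {τ : ℂ} (hτ : 0 < τ.im) :
    HasSum ({p : ℤ × ℤ | Even p.1}.indicator (hexTerm τ))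
      (theta3 (2 * τ) * theta3 (6 * τ)) := by
  have hr : {p : ℤ × ℤ | Even p.1} = Set.range fun p : ℤ × ℤ => (2 * p.2, p.1 - p.2) := by
    ext ⟨m, n⟩
    simp only [Set.mem_ofPred_eq, Set.mem_range, Prod.exists, Prod.mk.injEq]
    exact ⟨fun ⟨k, hk⟩ => ⟨n + k, k, by omega⟩, fun ⟨a, b, h⟩ => ⟨b, by omega⟩⟩
  rw [hr]
  refine hasSum_indicator_theta3_mul hτ ?_ fun p => by ring
  rintro ⟨a, b⟩ ⟨c, d⟩ h
  simp only [Prod.mk.injEq] at h ⊢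
  omega

lemma hasSum_add_even {τ : ℂ} (hτ : 0 < τ.im) :
    HasSum ({p : ℤ × ℤ | Even (p.1 + p.2)}.indicator (hexTerm τ))
      (theta3 (2 * τ) * theta3 (6 * τ)) := by
  have hr : {p : ℤ × ℤ | Even (p.1 + p.2)} =
      Set.range fun p : ℤ × ℤ => (p.1 - p.2, -p.1 - p.2) := by
    ext ⟨m, n⟩
    simp only [Set.mem_ofPred_eq, Set.mem_range, Prod.exists, Prod.mk.injEq]
    exact ⟨fun ⟨k, hk⟩ => ⟨m - k, -k, by omega⟩, fun ⟨a, b, h⟩ => ⟨-b, by omega⟩⟩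
  rw [hr]
  refine hasSum_indicator_theta3_mul hτ ?_ fun p => by ring
  rintro ⟨a, b⟩ ⟨c, d⟩ h
  simp only [Prod.mk.injEq] at h ⊢
  omega

lemma hasSum_snd_odd {τ : ℂ} (hτ : 0 < τ.im) :
    HasSum ({p : ℤ × ℤ | Even p.2}ᶜ.indicator (hexTerm τ))
      (theta2 (2 * τ) * theta2 (6 * τ)) := by
  have hr : {p : ℤ × ℤ | Even p.2}ᶜ =
      Set.range fun p : ℤ × ℤ => (p.1 - p.2, 2 * p.2 + 1) := by
    ext ⟨m, n⟩
    simp only [Set.mem_compl_iff, Set.mem_ofPred_eq, Int.not_even_iff_odd, Set.mem_range,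
      Prod.exists, Prod.mk.injEq]
    exact ⟨fun ⟨k, hk⟩ => ⟨m + k, k, by omega⟩, fun ⟨a, b, h⟩ => ⟨b, by omega⟩⟩
  have he : Function.Injective fun p : ℤ × ℤ => (p.1 - p.2, 2 * p.2 + 1) := by
    rintro ⟨a, b⟩ ⟨c, d⟩ h
    simp only [Prod.mk.injEq] at h ⊢
    omega
  rw [hr, ← hasSum_subtype_iff_indicator]
  refine he.hasSum_range_iff.2 ((hasSum_mul_of_summable
    (summable_theta2_term (τ := 2 * τ) (by simpa using hτ))
    (summable_theta2_term (τ := 6 * τ) (by simpa using hτ))).congr_fun fun p => ?_)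
  simp only [Function.comp_apply, hexTerm]
  rw [← Complex.exp_add]
  push_cast
  ring_nf

lemma hasSum_hexTerm {τ : ℂ} (hτ : 0 < τ.im) :
    HasSum (hexTerm τ)
      (theta3 (2 * τ) * theta3 (6 * τ) + theta2 (2 * τ) * theta2 (6 * τ)) := by
  exact ((hasSum_snd_even hτ).add (hasSum_snd_odd hτ)).congr_fun fun p =>
    (Set.indicator_self_add_compl_apply _ _ p).symm

lemma hasSum_both_even {τ : ℂ} (hτ : 0 < τ.im) :
    HasSum ({p : ℤ × ℤ | Even p.1 ∧ Even p.2}.indicator (hexTerm τ)) (A3 (4 * τ)) := by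
  have hr : {p : ℤ × ℤ | Even p.1 ∧ Even p.2} =
      Set.range fun p : ℤ × ℤ => (2 * p.1, 2 * p.2) := by
    ext ⟨m, n⟩
    simp only [Set.mem_ofPred_eq, Set.mem_range, Prod.exists, Prod.mk.injEq]
    exact ⟨fun ⟨⟨k, hk⟩, ⟨l, hl⟩⟩ => ⟨k, l, by omega⟩,
      fun ⟨a, b, h⟩ => ⟨⟨a, by omega⟩, ⟨b, by omega⟩⟩⟩
  have he : Function.Injective fun p : ℤ × ℤ => (2 * p.1, 2 * p.2) := by
    rintro ⟨a, b⟩ ⟨c, d⟩ h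
    simp only [Prod.mk.injEq] at h ⊢
    omega
  rw [hr, ← hasSum_subtype_iff_indicator]
  refine he.hasSum_range_iff.2 (((hasSum_hexTerm (τ := 4 * τ)
    (by simpa using hτ)).summable.hasSum).congr_fun fun p => ?_)
  simp only [Function.comp_apply, hexTerm]
  push_cast
  ring_nf

/-- Of `m`, `n`, `m + n` either exactly one is even or all three are. -/
lemma three_mul_theta3_mul {τ : ℂ} (hτ : 0 < τ.im) :
    3 * (theta3 (2 * τ) * theta3 (6 * τ)) = A3 τ + 2 * A3 (4 * τ) := by
  have h₁ := ((hasSum_fst_even hτ).add (hasSum_snd_even hτ)).add (hasSum_add_even hτ)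
  have h₂ := (hasSum_hexTerm hτ).summable.hasSum.add ((hasSum_both_even hτ).mul_left 2)
  have h := h₁.unique (h₂.congr_fun fun p => ?_)
  · rw [show A3 τ = ∑' p, hexTerm τ p from rfl, ← h]
    ring
  · by_cases hm : Even p.1 <;> by_cases hn : Even p.2 <;>
      simp [Set.indicator, hm, hn, Int.even_add]
    ring

theorem theta_products_via_A3 (τ : ℂ) (hτ : 0 < τ.im) :
    theta2 (2 * τ) * theta2 (6 * τ) = (2 / 3) * (A3 τ - A3 (4 * τ)) ∧
    theta3 (2 * τ) * theta3 (6 * τ) = (1 / 3) * A3 τ + (2 / 3) * A3 (4 * τ) := by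
  have hA : A3 τ = _ := (hasSum_hexTerm hτ).tsum_eq
  have h := three_mul_theta3_mul hτ
  constructor
  · linear_combination -hA - h / 3
  · linear_combination h / 3
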